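/- Let d ≥ 1, N ≥ 1, L > 0, λ ≥ max(1, L²), and let x_1, …, x_T ∈ ℝ^d satisfy ‖x_t‖₂ ≤ L for all t, with an assignment a_t ∈ {1, …, N} of each round to an agent. Set V_t = λ I_d + Σ_{s=1}^{t−1} x_s x_sᵀ and W_t = λ I_d + Σ_{s < t, a_s ≠ a_t} x_s x_sᵀ. Let C > 0 satisfy det(V_t) ≤ C · det(W_t) for all t ≤ T, and let 0 < α_1 ≤ … ≤ α_T be nondecreasing positive reals. Then Σ_{t=1}^T 2 α_t ‖x_t‖_{W_t⁻¹} ≤ 2 α_T √( 2 d T (1 + C) log( 1 + T L² / (d λ) ) ). -/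

import Mathlib

open Matrix Real

/-- The weighted norm `‖z‖_M = √(zᵀ M z)` of a vector with respect to a matrix `M`. -/
noncomputable def wnorm {d : ℕ} (M : Matrix (Fin d) (Fin d) ℝ) (z : Fin d → ℝ) : ℝ :=
  Real.sqrt (z ⬝ᵥ M.mulVec z)

/-- The Euclidean norm `‖z‖₂ = √(zᵀ z)`. -/
noncomputable def l2norm {d : ℕ} (z : Fin d → ℝ) : ℝ :=
  Real.sqrt (z ⬝ᵥ z)

section WeightedNorms

variable {n : Type*} [Fintype n]

theorem Matrix.PosDef.add_sum_vecMulVec_self {ι : Type*} {M : Matrix n n ℝ} (hM : M.PosDef)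
    (s : Finset ι) (x : ι → n → ℝ) :
    (M + ∑ i ∈ s, vecMulVec (x i) (x i)).PosDef := by
  refine hM.add_posSemidef (posSemidef_sum s fun i _ => ?_)
  simpa using posSemidef_vecMulVec_self_star (x i)

variable [DecidableEq n]

theorem Matrix.PosDef.dotProduct_inv_mulVec_nonneg {M : Matrix n n ℝ} (hM : M.PosDef)
    (x : n → ℝ) : 0 ≤ x ⬝ᵥ M⁻¹ *ᵥ x := by
  simpa using hM.inv.posSemidef.dotProduct_mulVec_nonneg x

theorem Matrix.PosDef.dotProduct_inv_mulVec_comm {M : Matrix n n ℝ} (hM : M.PosDef)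
    (x y : n → ℝ) : x ⬝ᵥ M⁻¹ *ᵥ y = y ⬝ᵥ M⁻¹ *ᵥ x := by
  have h : (M⁻¹)ᵀ = M⁻¹ := by simpa using hM.inv.isHermitian.eq
  rw [dotProduct_mulVec, ← mulVec_transpose, h, dotProduct_comm]

/-- The matrix determinant lemma for a symmetric rank-one update. -/
theorem Matrix.PosDef.det_add_vecMulVec_self {M : Matrix n n ℝ} (hM : M.PosDef) (x : n → ℝ) :
    (M + vecMulVec x x).det = M.det * (1 + x ⬝ᵥ M⁻¹ *ᵥ x) := by
  have h := det_add_replicateCol_mul_replicateRow (ι := Unit) hM.det_pos.ne'.isUnit x x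
  rw [← vecMulVec_eq] at h
  rw [h, det_unique (n := Unit)]
  simp [Matrix.add_apply, Matrix.mul_assoc, mul_apply, dotProduct, mulVec]

theorem Matrix.PosDef.inv_add_vecMulVec_self {M : Matrix n n ℝ} (hM : M.PosDef) (y : n → ℝ) :
    (M + vecMulVec y y)⁻¹
      = M⁻¹ - (1 + y ⬝ᵥ M⁻¹ *ᵥ y)⁻¹ • vecMulVec (M⁻¹ *ᵥ y) (y ᵥ* M⁻¹) := by
  have hu : IsUnit M.det := hM.det_pos.ne'.isUnit
  have hq : 1 + y ⬝ᵥ M⁻¹ *ᵥ y ≠ 0 := by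
    have := hM.dotProduct_inv_mulVec_nonneg y
    positivity
  apply inv_eq_right_inv
  rw [Matrix.add_mul, Matrix.mul_sub, Matrix.mul_sub, Matrix.mul_smul, Matrix.mul_smul,
    mul_nonsing_inv _ hu, mul_vecMulVec, mulVec_mulVec, mul_nonsing_inv _ hu, one_mulVec,
    vecMulVec_mul, vecMulVec_mul_vecMulVec]
  ext i j
  simp only [Matrix.add_apply, Matrix.sub_apply, Matrix.smul_apply, vecMulVec_apply, smul_eq_mul,
    Pi.smul_apply]
  field_simp
  ring

theorem Matrix.PosDef.sq_dotProduct_inv_mulVec_le {M : Matrix n n ℝ} (hM : M.PosDef)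
    (x y : n → ℝ) :
    (x ⬝ᵥ M⁻¹ *ᵥ y) ^ 2 ≤ (x ⬝ᵥ M⁻¹ *ᵥ x) * (y ⬝ᵥ M⁻¹ *ᵥ y) := by
  have h : ∀ r : ℝ, 0 ≤ (y ⬝ᵥ M⁻¹ *ᵥ y) * (r * r) + 2 * (x ⬝ᵥ M⁻¹ *ᵥ y) * r
      + x ⬝ᵥ M⁻¹ *ᵥ x := by
    intro r
    have := hM.dotProduct_inv_mulVec_nonneg (x + r • y)
    simp only [mulVec_add, mulVec_smul, dotProduct_add, add_dotProduct, dotProduct_smul,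
      smul_dotProduct, smul_eq_mul, hM.dotProduct_inv_mulVec_comm y x] at this
    linarith
  have := discrim_le_zero h
  rw [discrim] at this
  linarith

theorem Matrix.PosDef.det_mul_dotProduct_inv_le_add_vecMulVec {M : Matrix n n ℝ} (hM : M.PosDef)
    (x y : n → ℝ) :
    M.det * (x ⬝ᵥ M⁻¹ *ᵥ x)
      ≤ (M + vecMulVec y y).det * (x ⬝ᵥ (M + vecMulVec y y)⁻¹ *ᵥ x) := by
  have hq : 0 < 1 + y ⬝ᵥ M⁻¹ *ᵥ y := by
    have := hM.dotProduct_inv_mulVec_nonneg y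
    positivity
  rw [hM.det_add_vecMulVec_self, hM.inv_add_vecMulVec_self, mul_assoc]
  refine mul_le_mul_of_nonneg_left ?_ hM.det_pos.le
  have hxy := hM.sq_dotProduct_inv_mulVec_le x y
  have hcomm := hM.dotProduct_inv_mulVec_comm x y
  rw [sub_mulVec, smul_mulVec, vecMulVec_mulVec, ← dotProduct_mulVec, dotProduct_sub,
    dotProduct_smul, dotProduct_smul, ← hcomm]
  simp only [smul_eq_mul, MulOpposite.smul_eq_mul_unop, MulOpposite.unop_op]
  rw [mul_sub, mul_inv_cancel_left₀ hq.ne']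
  linarith

/-- The determinant-ratio comparison of inverse quadratic forms. -/
theorem Matrix.PosDef.det_mul_dotProduct_inv_le_add_sum {ι : Type*} {M : Matrix n n ℝ}
    (hM : M.PosDef) (x : n → ℝ) (s : Finset ι) (y : ι → n → ℝ) :
    M.det * (x ⬝ᵥ M⁻¹ *ᵥ x)
      ≤ (M + ∑ i ∈ s, vecMulVec (y i) (y i)).det
        * (x ⬝ᵥ (M + ∑ i ∈ s, vecMulVec (y i) (y i))⁻¹ *ᵥ x) := by
  classical
  induction s using Finset.induction_on with
  | empty => simp
  | insert i s hi ih =>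
    rw [Finset.sum_insert hi, add_comm (vecMulVec _ _), ← add_assoc]
    exact ih.trans
      ((hM.add_sum_vecMulVec_self s y).det_mul_dotProduct_inv_le_add_vecMulVec x (y i))

theorem dotProduct_inv_smul_one_add_mulVec_le {c : ℝ} (hc : 0 < c) {P : Matrix n n ℝ}
    (hP : P.PosSemidef) (x : n → ℝ) :
    c * (x ⬝ᵥ (c • (1 : Matrix n n ℝ) + P)⁻¹ *ᵥ x) ≤ x ⬝ᵥ x := by
  have hM : (c • (1 : Matrix n n ℝ) + P).PosDef := (PosDef.smul PosDef.one hc).add_posSemidef hP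
  set M := c • (1 : Matrix n n ℝ) + P with hMdef
  set z := M⁻¹ *ᵥ x with hz
  have hx : x = c • z + P *ᵥ z := by
    have : M *ᵥ z = x := by
      rw [hz, mulVec_mulVec, mul_nonsing_inv _ hM.det_pos.ne'.isUnit, one_mulVec]
    rw [← this, hMdef, add_mulVec, smul_mulVec, one_mulVec]
  have hPz : 0 ≤ z ⬝ᵥ P *ᵥ z := by simpa using hP.dotProduct_mulVec_nonneg z
  have hsq : 0 ≤ (P *ᵥ z) ⬝ᵥ (P *ᵥ z) := by simpa using dotProduct_self_star_nonneg (P *ᵥ z)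
  clear_value z
  subst hx
  simp only [add_dotProduct, dotProduct_add, smul_dotProduct, dotProduct_smul, smul_eq_mul,
    dotProduct_comm (P *ᵥ z) z]
  nlinarith [mul_nonneg hc.le hPz]

/-- The determinant–trace inequality in logarithmic form. -/
theorem Matrix.PosDef.log_det_le_card_mul_log {M : Matrix n n ℝ} (hM : M.PosDef) {m : ℝ}
    (hm : 0 < m) (htr : M.trace ≤ Fintype.card n * m) :
    Real.log M.det ≤ Fintype.card n * Real.log m := by
  have hdet := hM.isHermitian.det_eq_prod_eigenvalues
  have htrace := hM.isHermitian.trace_eq_sum_eigenvalues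
  simp only [RCLike.ofReal_real_eq_id, id] at hdet htrace
  rw [hdet, Real.log_prod fun i _ => (hM.eigenvalues_pos i).ne']
  have h : ∀ i, Real.log (hM.isHermitian.eigenvalues i)
      ≤ Real.log m + (hM.isHermitian.eigenvalues i / m - 1) := by
    intro i
    have hi := hM.eigenvalues_pos i
    have := Real.log_le_sub_one_of_pos (div_pos hi hm)
    rw [Real.log_div hi.ne' hm.ne'] at this
    linarith
  refine (Finset.sum_le_sum fun i _ => h i).trans ?_
  rw [Finset.sum_add_distrib, Finset.sum_sub_distrib, ← Finset.sum_div, ← htrace]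
  have := (div_le_iff₀ hm).2 htr
  simp only [Finset.sum_const, Finset.card_univ, nsmul_eq_mul, mul_one]
  linarith

theorem Real.le_two_mul_log_one_add {q : ℝ} (h0 : 0 ≤ q) (h1 : q ≤ 1) :
    q ≤ 2 * Real.log (1 + q) := by
  have h := Real.le_log_one_add_of_nonneg h0
  have : q / 2 ≤ 2 * q / (q + 2) := by
    rw [div_le_div_iff₀ (by norm_num) (by linarith)]
    nlinarith
  linarith

/-- The elliptical potential inequality, in terms of the final determinant. -/
theorem sum_dotProduct_inv_le_log_det {c : ℝ} (hc : 0 < c) (x : ℕ → n → ℝ)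
    (V : ℕ → Matrix n n ℝ)
    (hV : ∀ t, V t = c • (1 : Matrix n n ℝ)
      + ∑ s ∈ Finset.Icc 1 (t - 1), vecMulVec (x s) (x s)) (T : ℕ)
    (hx : ∀ t ∈ Finset.Icc 1 T, x t ⬝ᵥ x t ≤ c) :
    ∑ t ∈ Finset.Icc 1 T, x t ⬝ᵥ (V t)⁻¹ *ᵥ x t
      ≤ 2 * (Real.log (V (T + 1)).det - Fintype.card n * Real.log c) := by
  have hVpos : ∀ t, (V t).PosDef := fun t =>
    hV t ▸ (PosDef.smul PosDef.one hc).add_sum_vecMulVec_self _ _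
  induction T with
  | zero => simp [hV]
  | succ T ih =>
    have hstep : V (T + 1 + 1) = V (T + 1) + vecMulVec (x (T + 1)) (x (T + 1)) := by
      rw [hV, hV (T + 1), Nat.add_sub_cancel, Nat.add_sub_cancel,
        Finset.sum_Icc_succ_top (by omega), add_assoc]
    have hq0 := (hVpos (T + 1)).dotProduct_inv_mulVec_nonneg (x (T + 1))
    have hq1 : x (T + 1) ⬝ᵥ (V (T + 1))⁻¹ *ᵥ x (T + 1) ≤ 1 := by
      have hP : (∑ s ∈ Finset.Icc 1 (T + 1 - 1), vecMulVec (x s) (x s)).PosSemidef :=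
        posSemidef_sum _ fun i _ => by simpa using posSemidef_vecMulVec_self_star (x i)
      have h := (dotProduct_inv_smul_one_add_mulVec_le hc hP (x (T + 1))).trans
        (hx _ (by simp))
      rw [← hV] at h
      exact le_of_mul_le_mul_left (by simpa using h) hc
    have hlog := Real.le_two_mul_log_one_add hq0 hq1
    have hih := ih fun t ht => hx t (Finset.Icc_subset_Icc_right (Nat.le_succ T) ht)
    rw [Finset.sum_Icc_succ_top (by omega), hstep, (hVpos _).det_add_vecMulVec_self,
      Real.log_mul (hVpos _).det_pos.ne' (by positivity)]
    linarith

end WeightedNorms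

theorem stmt16 {d N : ℕ} (hd : 1 ≤ d) (hN : 1 ≤ N) (L lam : ℝ) (hL : 0 < L)
    (hlam : max 1 (L ^ 2) ≤ lam) (T : ℕ)
    (x : ℕ → Fin d → ℝ) (hx : ∀ t ∈ Finset.Icc 1 T, l2norm (x t) ≤ L)
    (a : ℕ → Fin N)
    (V W : ℕ → Matrix (Fin d) (Fin d) ℝ)
    (hV : ∀ t, V t = lam • (1 : Matrix (Fin d) (Fin d) ℝ)
      + ∑ s ∈ Finset.Icc 1 (t - 1), Matrix.vecMulVec (x s) (x s))
    (hW : ∀ t, W t = lam • (1 : Matrix (Fin d) (Fin d) ℝ)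
      + ∑ s ∈ (Finset.Icc 1 (t - 1)).filter (fun s => a s ≠ a t),
          Matrix.vecMulVec (x s) (x s))
    (C : ℝ) (hC : 0 < C)
    (hdet : ∀ t ∈ Finset.Icc 1 T, (V t).det ≤ C * (W t).det)
    (α : ℕ → ℝ)
    (hαpos : ∀ t ∈ Finset.Icc 1 T, 0 < α t)
    (hαmono : ∀ s ∈ Finset.Icc 1 T, ∀ t ∈ Finset.Icc 1 T, s ≤ t → α s ≤ α t) :
    ∑ t ∈ Finset.Icc 1 T, 2 * α t * wnorm (W t)⁻¹ (x t)
      ≤ 2 * α T * Real.sqrt (2 * d * T * (1 + C) * Real.log (1 + T * L ^ 2 / (d * lam))) := by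
  have hlam0 : 0 < lam := lt_of_lt_of_le one_pos ((le_max_left _ _).trans hlam)
  have hd0 : (0 : ℝ) < d := by exact_mod_cast hd
  have hxL : ∀ t ∈ Finset.Icc 1 T, x t ⬝ᵥ x t ≤ L ^ 2 := fun t ht =>
    (Real.sqrt_le_left hL.le).1 (hx t ht)
  have hWpos : ∀ t, (W t).PosDef := fun t =>
    hW t ▸ (PosDef.smul PosDef.one hlam0).add_sum_vecMulVec_self _ _
  have hVpos : ∀ t, (V t).PosDef := fun t =>
    hV t ▸ (PosDef.smul PosDef.one hlam0).add_sum_vecMulVec_self _ _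
  have hVW : ∀ t, V t = W t + ∑ s ∈ (Finset.Icc 1 (t - 1)).filter (fun s => ¬ a s ≠ a t),
      vecMulVec (x s) (x s) := fun t => by
    rw [hV, hW, add_assoc, Finset.sum_filter_add_sum_filter_not]
  have hcompare : ∀ t ∈ Finset.Icc 1 T,
      x t ⬝ᵥ (W t)⁻¹ *ᵥ x t ≤ C * (x t ⬝ᵥ (V t)⁻¹ *ᵥ x t) := by
    intro t ht
    have h := (hWpos t).det_mul_dotProduct_inv_le_add_sum (x t)
      ((Finset.Icc 1 (t - 1)).filter (fun s => ¬ a s ≠ a t)) x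
    rw [← hVW] at h
    have h' := mul_le_mul_of_nonneg_right (hdet t ht)
      ((hVpos t).dotProduct_inv_mulVec_nonneg (x t))
    refine le_of_mul_le_mul_left ?_ (hWpos t).det_pos
    linarith
  have hpotential := sum_dotProduct_inv_le_log_det hlam0 x V hV T fun t ht =>
    (hxL t ht).trans ((le_max_right _ _).trans hlam)
  set r : ℝ := 1 + T * L ^ 2 / (d * lam) with hr
  have hr1 : 1 ≤ r := by
    have : 0 ≤ T * L ^ 2 / (d * lam) := by positivity
    linarith
  have hlogdet : Real.log (V (T + 1)).det ≤ d * (Real.log lam + Real.log r) := by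
    rw [← Real.log_mul hlam0.ne' (by positivity)]
    have htr : (V (T + 1)).trace ≤ Fintype.card (Fin d) * (lam * r) := by
      have hsum := Finset.sum_le_card_nsmul _ _ _ hxL
      have hdr : (d : ℝ) * (lam * r) = d * lam + T * L ^ 2 := by
        rw [hr]
        field_simp
      rw [Fintype.card_fin, hdr, hV, trace_add, trace_smul, trace_one, trace_sum]
      simp only [trace_vecMulVec, Fintype.card_fin, Nat.add_sub_cancel, Nat.card_Icc,
        nsmul_eq_mul, smul_eq_mul] at hsum ⊢
      linarith
    simpa using (hVpos (T + 1)).log_det_le_card_mul_log (by positivity) htr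
  rw [Fintype.card_fin] at hpotential
  have hquad : ∑ t ∈ Finset.Icc 1 T, wnorm (W t)⁻¹ (x t) ^ 2
      ≤ 2 * d * (1 + C) * Real.log r := by
    have hlog := Real.log_nonneg hr1
    calc ∑ t ∈ Finset.Icc 1 T, wnorm (W t)⁻¹ (x t) ^ 2
        ≤ ∑ t ∈ Finset.Icc 1 T, C * (x t ⬝ᵥ (V t)⁻¹ *ᵥ x t) :=
          Finset.sum_le_sum fun t ht => by
            rw [wnorm, Real.sq_sqrt ((hWpos t).dotProduct_inv_mulVec_nonneg _)]
            exact hcompare t ht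
      _ ≤ C * (2 * (d * Real.log r)) := by
          rw [← Finset.mul_sum]
          exact mul_le_mul_of_nonneg_left (by linarith) hC.le
      _ ≤ 2 * d * (1 + C) * Real.log r := by
          have : 0 ≤ d * Real.log r := by positivity
          linarith
  have hcs : ∑ t ∈ Finset.Icc 1 T, wnorm (W t)⁻¹ (x t)
      ≤ Real.sqrt (2 * d * T * (1 + C) * Real.log r) := by
    refine Real.le_sqrt_of_sq_le (sq_sum_le_card_mul_sum_sq.trans ?_)
    rw [Nat.card_Icc, Nat.add_sub_cancel]
    have := mul_le_mul_of_nonneg_left hquad (Nat.cast_nonneg (α := ℝ) T)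
    linarith
  rcases Nat.eq_zero_or_pos T with rfl | hT
  · simp
  have hTmem : T ∈ Finset.Icc 1 T := Finset.mem_Icc.2 ⟨hT, le_rfl⟩
  calc ∑ t ∈ Finset.Icc 1 T, 2 * α t * wnorm (W t)⁻¹ (x t)
      ≤ ∑ t ∈ Finset.Icc 1 T, 2 * α T * wnorm (W t)⁻¹ (x t) :=
        Finset.sum_le_sum fun t ht => mul_le_mul_of_nonneg_right
          (by linarith [hαmono t ht T hTmem (Finset.mem_Icc.1 ht).2]) (Real.sqrt_nonneg _)
    _ ≤ 2 * α T * Real.sqrt (2 * d * T * (1 + C) * Real.log r) := by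
        rw [← Finset.mul_sum]
        exact mul_le_mul_of_nonneg_left hcs (by linarith [hαpos T hTmem])
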